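/- Let X be a Banach two-sided ℍ-module, let D(A) be a right ℍ-submodule of X, and let A : D(A) → X be a closed right linear operator such that ρ_S(A) ∩ ℝ ≠ ∅. Let q0 ∈ ρ_S(A) and set R := ‖Q_{q0}(A)‖^{−1/2}. Then for every q ∈ U(q0,R), the series Σ_{n=0}^∞ (−1)ⁿ B_{n+1} p_{q0,n}(q) converges in Lin^r(X) and its sum equals S_q⁻¹(A). -/

import Mathlib

open MulOpposite Filter Topology Classical

noncomputable section

notation "ℍ" => Quaternion ℝ

/-- A *Banach two-sided `ℍ`-module*: a two-sided `ℍ`-module (left `ℍ`-action, right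
`ℍ`-action encoded as a left `ℍᵐᵒᵖ`-action) whose complete norm satisfies
`‖qx‖ = ‖xq‖ = |q|‖x‖`, and where real scalars act the same on both sides. -/
class QuatBimodule (Y : Type*) [NormedAddCommGroup Y]
    [Module ℍ Y] [Module ℍᵐᵒᵖ Y] : Prop where
  smul_op_comm : ∀ (p q : ℍ) (y : Y), p • (op q • y) = op q • (p • y)
  norm_smul_left : ∀ (q : ℍ) (y : Y), ‖q • y‖ = ‖q‖ * ‖y‖
  norm_smul_right : ∀ (q : ℍ) (y : Y), ‖op q • y‖ = ‖q‖ * ‖y‖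
  real_smul_comm : ∀ (r : ℝ) (y : Y), ((r : ℝ) : ℍ) • y = op ((r : ℝ) : ℍ) • y

variable {X : Type*} [NormedAddCommGroup X] [Module ℍ X] [Module ℍᵐᵒᵖ X]

/-- Membership in `Lin^r(X)`: additive, right `ℍ`-linear, with finite operator
norm (i.e. `‖B x‖` is bounded on the closed unit ball). -/
def MemLinR (B : X → X) : Prop :=
  (∀ x y : X, B (x + y) = B x + B y) ∧
  (∀ (q : ℍ) (x : X), B (op q • x) = op q • B x) ∧
  BddAbove ((fun x : X => ‖B x‖) '' {x : X | ‖x‖ ≤ 1})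

/-- The operator norm `‖B‖ = sup {‖B x‖ : ‖x‖ ≤ 1}`. -/
def opNorm (B : X → X) : ℝ :=
  sSup ((fun x : X => ‖B x‖) '' {x : X | ‖x‖ ≤ 1})

/-- A right linear operator `A : D(A) → X`, where `D(A)` is a right `ℍ`-submodule
of `X`.  It is encoded as a function `X → X` together with its domain; only the
values on the domain are relevant. -/
structure RightLinearOp (X : Type*) [NormedAddCommGroup X]
    [Module ℍ X] [Module ℍᵐᵒᵖ X] where
  dom : Set X
  toFun : X → X
  zero_mem : (0 : X) ∈ dom
  add_mem : ∀ ⦃x⦄, x ∈ dom → ∀ ⦃y⦄, y ∈ dom → x + y ∈ dom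
  neg_mem : ∀ ⦃x⦄, x ∈ dom → -x ∈ dom
  smulR_mem : ∀ (q : ℍ) ⦃x⦄, x ∈ dom → op q • x ∈ dom
  map_add' : ∀ ⦃x⦄, x ∈ dom → ∀ ⦃y⦄, y ∈ dom → toFun (x + y) = toFun x + toFun y
  map_smulR' : ∀ (q : ℍ) ⦃x⦄, x ∈ dom → toFun (op q • x) = op q • toFun x

namespace RightLinearOp

variable (T : RightLinearOp X)

/-- `A` is closed: its graph is closed in `X × X`. -/
def IsClosedOp : Prop := IsClosed {p : X × X | p.1 ∈ T.dom ∧ T.toFun p.1 = p.2}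

/-- The domain `D(A²)` of `A²`. -/
def dom2 : Set X := {x | x ∈ T.dom ∧ T.toFun x ∈ T.dom}

/-- The operator `Δ_q(A) = A² − 2 Re(q) A + |q|² Id`, with domain `D(A²)`. -/
def delta (q : ℍ) (x : X) : X :=
  T.toFun (T.toFun x) - ((2 * q.re : ℝ) : ℍ) • T.toFun x + ((‖q‖ ^ 2 : ℝ) : ℍ) • x

/-- `B` is the inverse of `Δ_q(A) : D(A²) → X`, and `B ∈ Lin^r(X)`. -/
def IsQInv (q : ℍ) (B : X → X) : Prop :=
  MemLinR B ∧ (∀ x : X, B x ∈ T.dom2) ∧ (∀ x : X, T.delta q (B x) = x) ∧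
    ∀ x ∈ T.dom2, B (T.delta q x) = x

/-- The S-resolvent set `ρ_S(A)`. -/
def rhoS : Set ℍ := {q | ∃ B : X → X, T.IsQInv q B}

/-- `Q_q(A) = Δ_q(A)⁻¹ ∈ Lin^r(X)`, for `q ∈ ρ_S(A)` (junk value otherwise). -/
def qres (q : ℍ) : X → X :=
  if h : q ∈ T.rhoS then h.choose else fun _ => 0

/-- The (left) S-resolvent operator `S_q⁻¹(A) = Q_q(A) q̄ − A Q_q(A)`, where the
right scalar multiple of an operator is `(B q̄)(x) = B(q̄ x)`. -/
def sres (q : ℍ) : X → X :=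
  fun x => T.qres q (star q • x) - T.toFun (T.qres q x)

/-- The coefficients `B_n`: `B_{2k} = Q_{q0}(A)^k`, `B_{2k+1} = Q_{q0}(A)^k S_{q0}⁻¹(A)`. -/
def Bop (q0 : ℍ) (n : ℕ) : X → X :=
  if n % 2 = 0 then (T.qres q0)^[n / 2] else (T.qres q0)^[n / 2] ∘ T.sres q0

end RightLinearOp

/-- The quaternionic polynomial `Δ_q(p) = p² − 2 Re(q) p + |q|²`. -/
def deltaPoly (q p : ℍ) : ℍ :=
  p ^ 2 - ((2 * q.re : ℝ) : ℍ) * p + ((‖q‖ ^ 2 : ℝ) : ℍ)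

/-- The "powers" `p_{q0,n}`: `p_{q0,2k}(q) = Δ_{q0}(q)^k`,
`p_{q0,2k+1}(q) = (q − q0) Δ_{q0}(q)^k`. -/
def spow (q0 : ℍ) (n : ℕ) (q : ℍ) : ℍ :=
  if n % 2 = 0 then deltaPoly q0 q ^ (n / 2) else (q - q0) * deltaPoly q0 q ^ (n / 2)

/-- The Cassini pseudo-metric `u(p,q) = √|Δ_q(p)|`. -/
def cassini (p q : ℍ) : ℝ := Real.sqrt ‖deltaPoly q p‖

/-- The Cassini ball `U(q0,R)`. -/
def cassiniBall (q0 : ℍ) (R : ℝ) : Set ℍ := {p : ℍ | cassini p q0 < R}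

/-- The Cassini topology on `ℍ`: the topology induced by the Cassini pseudo-metric,
i.e. the topology generated by the Cassini balls. -/
def cassiniTopology : TopologicalSpace ℍ :=
  TopologicalSpace.generateFrom {U : Set ℍ | ∃ q0 R, 0 < R ∧ U = cassiniBall q0 R}

/-- The spherical derivative of a function `g : ℍ → ℍ`. -/
def sderivQ (g : ℍ → ℍ) (q : ℍ) : ℍ :=
  if q.im = 0 then deriv (fun t : ℝ => g ((t : ℝ) : ℍ)) q.re
  else (g q - g (star q)) * (q - star q)⁻¹

end

theorem norm_sq_eq_components (q : ℍ) :
    ‖q‖ ^ 2 = q.re ^ 2 + q.imI ^ 2 + q.imJ ^ 2 + q.imK ^ 2 := by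
  rw [sq, ← Quaternion.normSq_eq_norm_mul_self, Quaternion.normSq_def']

theorem deltaPoly_eq (q0 q : ℍ) :
    deltaPoly q0 q =
      ((2 * (q.re - q0.re) : ℝ) : ℍ) * q - ((‖q‖ ^ 2 - ‖q0‖ ^ 2 : ℝ) : ℍ) := by
  rw [deltaPoly, norm_sq_eq_components q]
  ext <;> simp [pow_two] <;> ring

theorem deltaPoly_re (q0 q : ℍ) :
    (deltaPoly q0 q).re = 2 * (q.re - q0.re) * q.re - (‖q‖ ^ 2 - ‖q0‖ ^ 2) := by
  rw [deltaPoly_eq, Quaternion.re_sub, Quaternion.re_coe]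
  simp

theorem norm_sq_deltaPoly (q0 q : ℍ) :
    ‖deltaPoly q0 q‖ ^ 2 = 4 * (q.re - q0.re) ^ 2 * ‖q‖ ^ 2
      - 4 * (q.re - q0.re) * (‖q‖ ^ 2 - ‖q0‖ ^ 2) * q.re + (‖q‖ ^ 2 - ‖q0‖ ^ 2) ^ 2 := by
  rw [deltaPoly_eq, norm_sq_eq_components]
  generalize ‖q‖ ^ 2 - ‖q0‖ ^ 2 = b
  rw [norm_sq_eq_components q]
  simp
  ring

theorem spow_even (q0 q : ℍ) (M : ℕ) : spow q0 (2 * M) q = deltaPoly q0 q ^ M := by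
  simp [spow]

theorem spow_odd (q0 q : ℍ) (M : ℕ) :
    spow q0 (2 * M + 1) q = (q - q0) * deltaPoly q0 q ^ M := by
  have h : (2 * M + 1) / 2 = M := by omega
  simp [spow, h]

theorem mul_norm_deltaPoly_lt_one {q0 q : ℍ} {c : ℝ}
    (hq : q ∈ cassiniBall q0 (Real.sqrt c)⁻¹) : c * ‖deltaPoly q0 q‖ < 1 := by
  change Real.sqrt ‖deltaPoly q0 q‖ < (Real.sqrt c)⁻¹ at hq
  rw [← Real.sqrt_inv, Real.sqrt_lt_sqrt_iff (norm_nonneg _)] at hq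
  have hc' : 0 < c := inv_pos.1 ((norm_nonneg _).trans_lt hq)
  exact (lt_inv_mul_iff₀ hc').1 (by rwa [mul_one])

theorem opNorm_nonneg {X : Type*} [NormedAddCommGroup X] (B : X → X) : 0 ≤ opNorm B :=
  Real.sSup_nonneg (by rintro _ ⟨x, -, rfl⟩; exact norm_nonneg _)

theorem opNorm_le {X : Type*} [NormedAddCommGroup X] {B : X → X} {K : ℝ}
    (h : ∀ x, ‖x‖ ≤ 1 → ‖B x‖ ≤ K) : opNorm B ≤ K :=
  csSup_le ⟨_, 0, by simp, rfl⟩ (by rintro _ ⟨x, hx, rfl⟩; exact h x hx)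

theorem QuatBimodule.smul_real_smul {X : Type*} [NormedAddCommGroup X] [Module ℍ X]
    [NormedSpace ℝ X] (hs : ∀ (r : ℝ) (x : X), r • x = (r : ℍ) • x)
    (q : ℍ) (r : ℝ) (x : X) : q • r • x = r • q • x := by
  rw [hs, hs, smul_smul, smul_smul, Quaternion.coe_commutes]

section RealStructure

variable {X : Type*} [NormedAddCommGroup X] [Module ℍ X] [Module ℍᵐᵒᵖ X]

/-- The real normed space underlying a Banach two-sided `ℍ`-module. -/
noncomputable abbrev QuatBimodule.normedSpaceReal [QuatBimodule X] : NormedSpace ℝ X :=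
  { Module.compHom X (algebraMap ℝ ℍ) with
    norm_smul_le := fun r x => by
      change ‖((r : ℝ) : ℍ) • x‖ ≤ _
      rw [QuatBimodule.norm_smul_left, Quaternion.norm_coe] }

theorem RightLinearOp.IsQInv.unique {T : RightLinearOp X} {q : ℍ} {B B' : X → X}
    (h : T.IsQInv q B) (h' : T.IsQInv q B') : B = B' := by
  funext x
  conv_lhs => rw [← h'.2.2.1 x]
  exact h.2.2.2 _ (h'.2.1 x)

theorem RightLinearOp.isQInv_qres {T : RightLinearOp X} {q : ℍ} (h : q ∈ T.rhoS) :
    T.IsQInv q (T.qres q) := by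
  rw [RightLinearOp.qres, dif_pos h]
  exact h.choose_spec

variable [NormedSpace ℝ X]

theorem QuatBimodule.op_smul_real_smul [QuatBimodule X]
    (hs : ∀ (r : ℝ) (x : X), r • x = (r : ℍ) • x) (q : ℍ) (r : ℝ) (x : X) :
    op q • r • x = r • op q • x := by
  rw [hs, hs, QuatBimodule.smul_op_comm]

theorem QuatBimodule.real_smul_eq_op [QuatBimodule X]
    (hs : ∀ (r : ℝ) (x : X), r • x = (r : ℍ) • x) (r : ℝ) (x : X) :
    r • x = op (r : ℍ) • x := by
  rw [hs, QuatBimodule.real_smul_comm]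

/-- Right multiplication by a quaternion, as a bounded real linear operator. -/
noncomputable def QuatBimodule.rightMul [QuatBimodule X]
    (hs : ∀ (r : ℝ) (x : X), r • x = (r : ℍ) • x) (q : ℍ) : X →L[ℝ] X :=
  LinearMap.mkContinuous
    { toFun := fun x => op q • x
      map_add' := smul_add _
      map_smul' := QuatBimodule.op_smul_real_smul hs q } ‖q‖
    fun x => (QuatBimodule.norm_smul_right q x).le

theorem QuatBimodule.rightMul_apply [QuatBimodule X]
    (hs : ∀ (r : ℝ) (x : X), r • x = (r : ℍ) • x) (q : ℍ) (x : X) :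
    QuatBimodule.rightMul hs q x = op q • x := rfl

theorem MemLinR.norm_le [QuatBimodule X] (hs : ∀ (r : ℝ) (x : X), r • x = (r : ℍ) • x)
    {B : X → X} (hB : MemLinR B) (x : X) : ‖B x‖ ≤ opNorm B * ‖x‖ := by
  have hr (r : ℝ) (x : X) : B (r • x) = r • B x := by
    rw [QuatBimodule.real_smul_eq_op hs, hB.2.1, ← QuatBimodule.real_smul_eq_op hs]
  rcases eq_or_ne x 0 with rfl | hx
  · simpa using congrArg norm (hr 0 0)
  · have hx' : 0 < ‖x‖ := norm_pos_iff.2 hx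
    have h1 : ‖B (‖x‖⁻¹ • x)‖ ≤ opNorm B :=
      le_csSup hB.2.2 ⟨‖x‖⁻¹ • x, by simp [norm_smul, hx'.ne'], rfl⟩
    rw [hr, norm_smul, norm_inv, norm_norm, inv_mul_le_iff₀ hx'] at h1
    rwa [mul_comm]

namespace RightLinearOp

variable {T : RightLinearOp X}

theorem map_real_smul [QuatBimodule X] (hs : ∀ (r : ℝ) (x : X), r • x = (r : ℍ) • x)
    (r : ℝ) {x : X} (hx : x ∈ T.dom) : T.toFun (r • x) = r • T.toFun x := by
  rw [QuatBimodule.real_smul_eq_op hs, T.map_smulR' _ hx, ← QuatBimodule.real_smul_eq_op hs]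

theorem real_smul_mem [QuatBimodule X] (hs : ∀ (r : ℝ) (x : X), r • x = (r : ℍ) • x)
    (r : ℝ) {x : X} (hx : x ∈ T.dom) : r • x ∈ T.dom := by
  rw [QuatBimodule.real_smul_eq_op hs]
  exact T.smulR_mem _ hx

theorem delta_eq (hs : ∀ (r : ℝ) (x : X), r • x = (r : ℍ) • x) (q : ℍ) (x : X) :
    T.delta q x = T.toFun (T.toFun x) - (2 * q.re) • T.toFun x + ‖q‖ ^ 2 • x := by
  rw [delta, hs, hs]

/-- `P` and `C` are bounded operators representing `Q_q(A)` and `A Q_q(A)`. -/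
structure ResolventPair (T : RightLinearOp X) (q : ℍ) (P C : X →L[ℝ] X) : Prop where
  isQInv : T.IsQInv q P
  eq_map : ∀ x, C x = T.toFun (P x)

theorem exists_resolventPair [CompleteSpace X] [QuatBimodule X]
    (hs : ∀ (r : ℝ) (x : X), r • x = (r : ℍ) • x) (hT : T.IsClosedOp)
    {q : ℍ} (hq : q ∈ T.rhoS) : ∃ P C : X →L[ℝ] X, T.ResolventPair q P C := by
  obtain ⟨B, hB⟩ := hq
  have hr (r : ℝ) (x : X) : B (r • x) = r • B x := by
    rw [QuatBimodule.real_smul_eq_op hs, hB.1.2.1, ← QuatBimodule.real_smul_eq_op hs]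
  let P : X →L[ℝ] X := LinearMap.mkContinuous
    { toFun := B, map_add' := hB.1.1, map_smul' := hr } (opNorm B) (hB.1.norm_le hs)
  have hdom (x : X) : B x ∈ T.dom := (hB.2.1 x).1
  let C₀ : X →ₗ[ℝ] X :=
    { toFun := fun x => T.toFun (B x)
      map_add' := fun x y => by rw [hB.1.1, T.map_add' (hdom x) (hdom y)]
      map_smul' := fun r x => by rw [hr, map_real_smul hs r (hdom x), RingHom.id_apply] }
  have hC₀ : Continuous C₀ := by
    refine C₀.continuous_of_seq_closed_graph fun u x y hu hy => ?_
    have hP : Tendsto (fun n => (P (u n), T.toFun (P (u n)))) atTop (𝓝 (P x, y)) :=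
      ((P.continuous.tendsto x).comp hu).prodMk_nhds hy
    exact (hT.mem_of_tendsto hP (Eventually.of_forall fun n => ⟨hdom _, rfl⟩)).2.symm
  exact ⟨P, ⟨C₀, hC₀⟩, hB, fun x => rfl⟩

namespace ResolventPair

variable {q : ℍ} {P C : X →L[ℝ] X}

theorem mem_dom (h : T.ResolventPair q P C) (x : X) : P x ∈ T.dom := (h.isQInv.2.1 x).1

theorem map_mem_dom (h : T.ResolventPair q P C) (x : X) : C x ∈ T.dom := by
  rw [h.eq_map]
  exact (h.isQInv.2.1 x).2

theorem map_op_smul (h : T.ResolventPair q P C) (p : ℍ) (x : X) :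
    P (op p • x) = op p • P x := h.isQInv.1.2.1 p x

theorem map_op_smul' (h : T.ResolventPair q P C) (p : ℍ) (x : X) :
    C (op p • x) = op p • C x := by
  rw [h.eq_map, h.map_op_smul, T.map_smulR' p (h.mem_dom x), ← h.eq_map]

theorem map_map (hs : ∀ (r : ℝ) (x : X), r • x = (r : ℍ) • x) (h : T.ResolventPair q P C)
    (x : X) : T.toFun (C x) = x + (2 * q.re) • C x - ‖q‖ ^ 2 • P x := by
  have := h.isQInv.2.2.1 x
  rw [delta_eq hs, ← h.eq_map] at this
  linear_combination (norm := module) this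

/-- `Q_q(A)` commutes with `A` on the domain of `A`. -/
theorem commute_map [QuatBimodule X] (hs : ∀ (r : ℝ) (x : X), r • x = (r : ℍ) • x)
    (h : T.ResolventPair q P C) {x : X} (hx : x ∈ T.dom) : P (T.toFun x) = C x := by
  have hmem : T.toFun (C x) ∈ T.dom := by
    rw [h.map_map hs, sub_eq_add_neg]
    exact T.add_mem (T.add_mem hx (real_smul_mem hs _ (h.map_mem_dom x)))
      (T.neg_mem (real_smul_mem hs _ (h.mem_dom x)))
  have hmap : T.toFun (T.toFun (C x)) =
      T.toFun x + (2 * q.re) • T.toFun (C x) - ‖q‖ ^ 2 • C x := by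
    have h1 := real_smul_mem hs (2 * q.re) (h.map_mem_dom x)
    have h2 := real_smul_mem hs (-‖q‖ ^ 2) (h.mem_dom x)
    have h3 : T.toFun (C x) = x + (2 * q.re) • C x + (-‖q‖ ^ 2) • P x := by
      rw [h.map_map hs]
      module
    conv_lhs => rw [h3]
    rw [T.map_add' (T.add_mem hx h1) h2, T.map_add' hx h1, map_real_smul hs _ (h.map_mem_dom x),
      map_real_smul hs _ (h.mem_dom x), ← h.eq_map]
    module
  have hdelta : T.delta q (C x) = T.toFun x := by
    rw [delta_eq hs, hmap]
    module
  rw [← hdelta]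
  exact h.isQInv.2.2.2 _ ⟨h.map_mem_dom x, hmem⟩

theorem comm [QuatBimodule X] (hs : ∀ (r : ℝ) (x : X), r • x = (r : ℍ) • x)
    (h : T.ResolventPair q P C) (x : X) : C (P x) = P (C x) := by
  rw [h.eq_map x, h.commute_map hs (h.mem_dom x)]

theorem map_self_self [QuatBimodule X] (hs : ∀ (r : ℝ) (x : X), r • x = (r : ℍ) • x)
    (h : T.ResolventPair q P C) (x : X) :
    C (C x) = P x + (2 * q.re) • P (C x) - ‖q‖ ^ 2 • P (P x) := by
  rw [← h.commute_map hs (h.map_mem_dom x), h.map_map hs]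
  simp only [map_add, map_sub, map_smul]

theorem norm_le [QuatBimodule X] (hs : ∀ (r : ℝ) (x : X), r • x = (r : ℍ) • x)
    (h : T.ResolventPair q P C) (x : X) : ‖P x‖ ≤ opNorm P * ‖x‖ :=
  h.isQInv.1.norm_le hs x

theorem delta_apply (hs : ∀ (r : ℝ) (x : X), r • x = (r : ℍ) • x)
    (h : T.ResolventPair q P C) (p : ℍ) (x : X) :
    T.delta p (P x) = x - (2 * (p.re - q.re)) • C x + (‖p‖ ^ 2 - ‖q‖ ^ 2) • P x := by
  rw [delta_eq hs, ← h.eq_map, h.map_map hs]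
  module

theorem isUnit_of_deltaPoly [CompleteSpace X] [QuatBimodule X]
    (hs : ∀ (r : ℝ) (x : X), r • x = (r : ℍ) • x) (h : T.ResolventPair q P C) {p : ℍ}
    (hp : opNorm P * ‖deltaPoly q p‖ < 1) :
    IsUnit (1 - (2 * (p.re - q.re)) • C + (‖p‖ ^ 2 - ‖q‖ ^ 2) • P) := by
  have hunit (d : ℍ) (hd : opNorm P * ‖d‖ < 1) :
      IsUnit (1 - P * QuatBimodule.rightMul hs d) := by
    refine isUnit_one_sub_of_norm_lt_one (lt_of_le_of_lt ?_ hd)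
    refine ContinuousLinearMap.opNorm_le_bound _
      (mul_nonneg (opNorm_nonneg _) (norm_nonneg _)) fun x => ?_
    rw [mul_apply_eq_comp, QuatBimodule.rightMul_apply, mul_assoc,
      ← QuatBimodule.norm_smul_right]
    exact h.norm_le hs _
  have hprod := (hunit _ hp).mul (hunit (star (deltaPoly q p)) (by rwa [norm_star]))
  have hfactor : (1 - P * QuatBimodule.rightMul hs (deltaPoly q p)) *
      (1 - P * QuatBimodule.rightMul hs (star (deltaPoly q p))) =
      (1 - (2 * (p.re - q.re)) • C + (‖p‖ ^ 2 - ‖q‖ ^ 2) • P) *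
      (1 + (2 * (p.re - q.re)) • C +
        (4 * q.re ^ 2 - 4 * q.re * p.re + ‖p‖ ^ 2 - ‖q‖ ^ 2) • P) := by
    ext x
    have h1 : QuatBimodule.rightMul hs (deltaPoly q p) (P x) +
        QuatBimodule.rightMul hs (star (deltaPoly q p)) (P x) =
        (2 * (deltaPoly q p).re) • P x := by
      rw [QuatBimodule.rightMul_apply, QuatBimodule.rightMul_apply,
        ← add_smul, ← op_add, Quaternion.self_add_star', ← QuatBimodule.real_smul_eq_op hs]
    have h2 : QuatBimodule.rightMul hs (deltaPoly q p)
        (QuatBimodule.rightMul hs (star (deltaPoly q p)) (P (P x))) =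
        ‖deltaPoly q p‖ ^ 2 • P (P x) := by
      rw [QuatBimodule.rightMul_apply, QuatBimodule.rightMul_apply,
        smul_smul, ← op_mul, Quaternion.star_mul_self, Quaternion.normSq_eq_norm_mul_self,
        ← sq, ← QuatBimodule.real_smul_eq_op hs]
    have h3 (d : ℍ) (y : X) :
        P (QuatBimodule.rightMul hs d y) = QuatBimodule.rightMul hs d (P y) :=
      h.map_op_smul d y
    rw [deltaPoly_re] at h1
    rw [norm_sq_deltaPoly] at h2
    simp only [mul_apply_eq_comp, sub_apply,
      add_apply, smul_apply,
      one_apply_eq_self, map_sub, map_add, map_smul, h3, h.comm hs,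
      h.map_self_self hs]
    linear_combination (norm := module) h2 - h1
  rw [hfactor] at hprod
  refine ((Commute.isUnit_mul_iff ?_).1 hprod).1
  ext x
  simp only [mul_apply_eq_comp, sub_apply,
    add_apply, smul_apply,
    one_apply_eq_self, map_sub, map_add, map_smul, h.comm hs]
  module

/-- The Cassini ball of radius `‖Q_q(A)‖^{-1/2}` around `q` lies in the S-resolvent set. -/
theorem mem_rhoS [CompleteSpace X] [QuatBimodule X]
    (hs : ∀ (r : ℝ) (x : X), r • x = (r : ℍ) • x) (h : T.ResolventPair q P C) {p : ℍ}
    (hp : opNorm P * ‖deltaPoly q p‖ < 1) : p ∈ T.rhoS := by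
  obtain ⟨u, hu⟩ := h.isUnit_of_deltaPoly hs hp
  have hdelta (x : X) : T.delta p (P x) = u.1 x := by
    rw [h.delta_apply hs, hu]
    rfl
  have hinv (x : X) : u.1 (u⁻¹.1 x) = x := by
    rw [← mul_apply_eq_comp, u.mul_inv, one_apply_eq_self]
  have hinv' (x : X) : u⁻¹.1 (u.1 x) = x := by
    rw [← mul_apply_eq_comp, u.inv_mul, one_apply_eq_self]
  have hop (d : ℍ) (x : X) : u⁻¹.1 (op d • x) = op d • u⁻¹.1 x := by
    have : u.1 (op d • u⁻¹.1 x) = op d • x := by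
      conv_rhs => rw [← hinv x]
      simp only [hu, sub_apply, add_apply,
        smul_apply, one_apply_eq_self, h.map_op_smul,
        h.map_op_smul', smul_add, smul_sub, QuatBimodule.op_smul_real_smul hs]
    rw [← this, hinv']
  refine ⟨fun x => P (u⁻¹.1 x), ⟨fun x y => by simp only [map_add],
    fun d x => by simp only [hop, h.map_op_smul], ?_⟩, fun x => h.isQInv.2.1 _,
    fun x => by rw [hdelta, hinv], fun x hx => ?_⟩
  · refine ⟨‖P * u⁻¹.1‖, ?_⟩
    rintro _ ⟨x, hx, rfl⟩
    exact (P * u⁻¹.1).unit_le_opNorm x hx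
  · conv_lhs => rw [← h.isQInv.2.2.2 x hx]
    simp only [hdelta, hinv']
    exact h.isQInv.2.2.2 x hx

/-- The S-resolvent operator at `p` is a fixed point of `G ↦ W + Q_q(A) ∘ G ∘ Δ_q(p)`, where
`W = S_q⁻¹(A) - Q_q(A) (p - q)`. -/
theorem sres_functional_equation [QuatBimodule X]
    (hs : ∀ (r : ℝ) (x : X), r • x = (r : ℍ) • x) (h : T.ResolventPair q P C) {p : ℍ}
    {Q D : X →L[ℝ] X} (h' : T.ResolventPair p Q D) (x : X) :
    Q (star p • x) - D x = P (star q • x) - C x - P ((p - q) • x) +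
      P (Q (star p • deltaPoly q p • x) - D (deltaPoly q p • x)) := by
  have hstar (d : ℍ) : d • x = (2 * d.re) • x - star d • x := by
    rw [hs, ← sub_smul, ← Quaternion.self_add_star', add_sub_cancel_right]
  have hdelta : deltaPoly q p • x = (2 * (p.re - q.re)) • ((2 * p.re) • x - star p • x)
      - (‖p‖ ^ 2 - ‖q‖ ^ 2) • x := by
    rw [← hstar, deltaPoly_eq, sub_smul, mul_smul, ← hs, ← hs]
  have hmul : star p • deltaPoly q p • x = (2 * (p.re - q.re) * ‖p‖ ^ 2) • x
      - (‖p‖ ^ 2 - ‖q‖ ^ 2) • star p • x := by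
    rw [deltaPoly_eq, sub_smul, mul_smul, ← hs, ← hs, smul_sub,
      QuatBimodule.smul_real_smul hs, QuatBimodule.smul_real_smul hs, smul_smul,
      Quaternion.star_mul_self, ← hs, Quaternion.normSq_eq_norm_mul_self]
    generalize star p • x = y
    module
  have hres (z : X) : P z - Q z = -(2 * (p.re - q.re)) • P (D z)
      + (‖p‖ ^ 2 - ‖q‖ ^ 2) • P (Q z) := by
    have h1 := h.isQInv.2.2.2 _ (h'.isQInv.2.1 z)
    rw [h'.delta_apply hs] at h1
    simp only [map_sub, map_add, map_smul] at h1
    linear_combination (norm := module) h1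
  have hCQ (z : X) : C (Q z) = P (D z) := by
    rw [h'.eq_map, h.commute_map hs (h'.mem_dom z)]
  have hCD (z : X) : C (D z) = P z + (2 * p.re) • P (D z) - ‖p‖ ^ 2 • P (Q z) := by
    rw [← h.commute_map hs (h'.map_mem_dom z), h'.map_map hs]
    simp only [map_add, map_sub, map_smul]
  have hres' (z : X) : C z - D z = -(2 * (p.re - q.re)) • C (D z)
      + (‖p‖ ^ 2 - ‖q‖ ^ 2) • C (Q z) := by
    have h1 : P z = Q z + ((-(2 * (p.re - q.re))) • P (D z)
        + (‖p‖ ^ 2 - ‖q‖ ^ 2) • P (Q z)) := by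
      rw [← hres]
      abel
    have hD := real_smul_mem hs (-(2 * (p.re - q.re))) (h.mem_dom (D z))
    have hQ := real_smul_mem hs (‖p‖ ^ 2 - ‖q‖ ^ 2) (h.mem_dom (Q z))
    rw [h.eq_map z, h1, T.map_add' (h'.mem_dom z) (T.add_mem hD hQ), T.map_add' hD hQ,
      map_real_smul hs _ (h.mem_dom _), map_real_smul hs _ (h.mem_dom _), ← h.eq_map,
      ← h.eq_map, ← h'.eq_map]
    abel
  have h1 := hres (star p • x)
  have h2 := hres' x
  rw [hCQ, hCD] at h2
  rw [hmul, hdelta, sub_smul, hstar p, hstar q]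
  generalize star p • x = y at *
  generalize star q • x = w at *
  simp only [map_sub, map_smul]
  linear_combination (norm := module) h2 - h1

theorem norm_iterate_le [QuatBimodule X] (hs : ∀ (r : ℝ) (x : X), r • x = (r : ℍ) • x)
    (h : T.ResolventPair q P C) (M : ℕ) (x : X) : ‖(P ^ M) x‖ ≤ opNorm P ^ M * ‖x‖ := by
  induction M with
  | zero => simp
  | succ M ih =>
    rw [pow_succ', mul_apply_eq_comp, pow_succ', mul_assoc]
    exact (h.norm_le hs _).trans (mul_le_mul_of_nonneg_left ih (opNorm_nonneg _))

theorem qres_eq (h : T.ResolventPair q P C) : T.qres q = P :=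
  (isQInv_qres ⟨_, h.isQInv⟩).unique h.isQInv

theorem sres_eq (h : T.ResolventPair q P C) (x : X) :
    T.sres q x = P (star q • x) - C x := by
  rw [sres, h.qres_eq, h.eq_map]

theorem norm_sres_le [QuatBimodule X] (h : T.ResolventPair q P C) (x : X) :
    ‖T.sres q x‖ ≤ (‖P‖ * ‖q‖ + ‖C‖) * ‖x‖ := by
  rw [h.sres_eq, add_mul, mul_assoc, ← norm_star q, ← QuatBimodule.norm_smul_left]
  exact (norm_sub_le _ _).trans (add_le_add (P.le_opNorm _) (C.le_opNorm _))

theorem Bop_even (h : T.ResolventPair q P C) (M : ℕ) : T.Bop q (2 * M) = ⇑(P ^ M) := by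
  simp [Bop, h.qres_eq, FunLike.coe_pow_eq_iterate]

theorem Bop_odd (h : T.ResolventPair q P C) (M : ℕ) :
    T.Bop q (2 * M + 1) = ⇑(P ^ M) ∘ T.sres q := by
  have h1 : (2 * M + 1) / 2 = M := by omega
  simp [Bop, h.qres_eq, h1, FunLike.coe_pow_eq_iterate]

theorem sum_even_sub_sres [QuatBimodule X] (hs : ∀ (r : ℝ) (x : X), r • x = (r : ℍ) • x)
    (h : T.ResolventPair q P C) {p : ℍ} {Q D : X →L[ℝ] X}
    (h' : T.ResolventPair p Q D) (M : ℕ) (x : X) :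
    (∑ n ∈ Finset.range (2 * M), T.Bop q (n + 1) (((-1 : ℍ) ^ n * spow q n p) • x)) -
      T.sres p x = -(P ^ M) (T.sres p (deltaPoly q p ^ M • x)) := by
  induction M with
  | zero => simp
  | succ M ih =>
    have hfix := h.sres_functional_equation hs h' (deltaPoly q p ^ M • x)
    rw [← h'.sres_eq, ← h.sres_eq, ← h'.sres_eq, smul_smul (deltaPoly q p), ← pow_succ'] at hfix
    rw [show 2 * (M + 1) = 2 * M + 1 + 1 by ring, Finset.sum_range_succ, Finset.sum_range_succ,
      h.Bop_odd, show 2 * M + 1 + 1 = 2 * (M + 1) by ring, h.Bop_even, spow_even, spow_odd,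
      Even.neg_one_pow ⟨M, two_mul M⟩, Odd.neg_one_pow ⟨M, rfl⟩, one_mul, neg_one_mul, neg_smul,
      mul_smul, Function.comp_apply, pow_succ P, mul_apply_eq_comp, mul_apply_eq_comp, add_assoc,
      add_sub_right_comm, ih, hfix]
    simp only [map_add, map_sub, map_neg]
    abel

theorem norm_sum_sub_sres_le [QuatBimodule X]
    (hs : ∀ (r : ℝ) (x : X), r • x = (r : ℍ) • x)
    (h : T.ResolventPair q P C) {p : ℍ} {Q D : X →L[ℝ] X}
    (h' : T.ResolventPair p Q D) (N : ℕ) {x : X} (hx : ‖x‖ ≤ 1) :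
    ‖(∑ n ∈ Finset.range N, T.Bop q (n + 1) (((-1 : ℍ) ^ n * spow q n p) • x)) -
      T.sres p x‖ ≤ (opNorm P * ‖deltaPoly q p‖) ^ (N / 2) *
        ((‖P‖ * ‖q‖ + ‖C‖) + (‖Q‖ * ‖p‖ + ‖D‖)) := by
  have hbound (M : ℕ) {r : ℍ} {P' C' : X →L[ℝ] X} (hr : T.ResolventPair r P' C') :
      ‖(P ^ M) (T.sres r (deltaPoly q p ^ M • x))‖ ≤
        (opNorm P * ‖deltaPoly q p‖) ^ M * (‖P'‖ * ‖r‖ + ‖C'‖) := by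
    have hy : ‖deltaPoly q p ^ M • x‖ ≤ ‖deltaPoly q p‖ ^ M := by
      rw [QuatBimodule.norm_smul_left, norm_pow]
      exact mul_le_of_le_one_right (by positivity) hx
    calc _ ≤ opNorm P ^ M * ‖T.sres r (deltaPoly q p ^ M • x)‖ := h.norm_iterate_le hs M _
      _ ≤ opNorm P ^ M * ((‖P'‖ * ‖r‖ + ‖C'‖) * ‖deltaPoly q p‖ ^ M) := by
        have := opNorm_nonneg P
        gcongr
        exact (hr.norm_sres_le _).trans (by gcongr)
      _ = _ := by ring
  have hc : 0 ≤ opNorm P * ‖deltaPoly q p‖ := mul_nonneg (opNorm_nonneg _) (norm_nonneg _)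
  rcases Nat.even_or_odd' N with ⟨M, rfl | rfl⟩
  · rw [h.sum_even_sub_sres hs h', norm_neg, Nat.mul_div_cancel_left M two_pos]
    refine (hbound M h').trans (mul_le_mul_of_nonneg_left ?_ (pow_nonneg hc M))
    exact le_add_of_nonneg_left (by positivity)
  · have h1 : (2 * M + 1) / 2 = M := by omega
    rw [Finset.sum_range_succ, add_sub_right_comm, h.sum_even_sub_sres hs h', h.Bop_odd,
      spow_even, Even.neg_one_pow ⟨M, two_mul M⟩, one_mul, Function.comp_apply, h1, add_comm,
      mul_add]
    refine (norm_add_le _ _).trans (add_le_add (hbound M h) ?_)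
    rw [norm_neg]
    exact hbound M h'

end ResolventPair

end RightLinearOp

end RealStructure

/-- Theorem `T:main`(iii): for every `q` in the Cassini ball
`U(q0, ‖Q_{q0}(A)‖^{-1/2})`, the series `Σ_{n=0}^∞ (−1)ⁿ B_{n+1} p_{q0,n}(q)`
converges in `Lin^r(X)` (i.e. in the operator norm) and its sum is `S_q⁻¹(A)`. -/
theorem stmt3 {X : Type*} [NormedAddCommGroup X] [CompleteSpace X]
    [Module ℍ X] [Module ℍᵐᵒᵖ X] [QuatBimodule X]
    (T : RightLinearOp X) (hT : T.IsClosedOp)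
    (hreal : ∃ r : ℝ, ((r : ℝ) : ℍ) ∈ T.rhoS)
    (q0 : ℍ) (hq0 : q0 ∈ T.rhoS) :
    ∀ q ∈ cassiniBall q0 (Real.sqrt (opNorm (T.qres q0)))⁻¹,
      Tendsto (fun N : ℕ => opNorm (fun x : X =>
          (∑ n ∈ Finset.range N,
            T.Bop q0 (n + 1) ((((-1 : ℍ) ^ n) * spow q0 n q) • x)) - T.sres q x))
        atTop (𝓝 0) := by
  intro q hq
  let _ : NormedSpace ℝ X := QuatBimodule.normedSpaceReal
  have hs : ∀ (r : ℝ) (x : X), r • x = (r : ℍ) • x := fun _ _ => rfl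
  obtain ⟨P, C, h⟩ := RightLinearOp.exists_resolventPair hs hT hq0
  rw [h.qres_eq] at hq
  have hlt := mul_norm_deltaPoly_lt_one hq
  obtain ⟨Q, D, h'⟩ := RightLinearOp.exists_resolventPair hs hT (h.mem_rhoS hs hlt)
  refine squeeze_zero (fun N => opNorm_nonneg _)
    (fun N => opNorm_le fun x hx => h.norm_sum_sub_sres_le hs h' N hx) ?_
  have hc : 0 ≤ opNorm P * ‖deltaPoly q0 q‖ := mul_nonneg (opNorm_nonneg _) (norm_nonneg _)
  simpa using (((tendsto_pow_atTop_nhds_zero_of_lt_one hc hlt).comp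
    (Nat.tendsto_div_const_atTop two_ne_zero)).mul_const
      ((‖P‖ * ‖q0‖ + ‖C‖) + (‖Q‖ * ‖q‖ + ‖D‖)))
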